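/- arXiv:1306.3142 — 2 statements merged into one kernel-verified Lean document; each statement's English description precedes it below -/
import Mathlib

section
/- Let ρ be a positive semidefinite complex n×n matrix with Tr[ρ] = 1, and let σ, τ be positive definite complex n×n matrices. Define, for α ∈ (0,1) ∪ (1,∞), the auxiliary quantity D̃_α(ρ‖σ; τ) = (α/(α−1)) · log Tr[ ρ^(1/2) σ^((1−α)/α) ρ^(1/2) τ^((α−1)/α) ] (logarithm base 2). Then α ↦ D̃_α(ρ‖σ; τ) is monotonically increasing: for all α, α' ∈ (0,1) ∪ (1,∞) with α ≤ α', one has D̃_α(ρ‖σ; τ) ≤ D̃_{α'}(ρ‖σ; τ). -/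
open Matrix
open scoped Kronecker Classical ComplexOrder

/-- Real power of a matrix via functional calculus on the eigenvalues of a Hermitian
matrix, with the convention that eigenvalue `0` is mapped to `0` (powers are taken on
the support). Non-Hermitian matrices are mapped to `0`. -/
noncomputable def matPow {n : Type*} [Fintype n] [DecidableEq n]
    (A : Matrix n n ℂ) (t : ℝ) : Matrix n n ℂ :=
  if hA : A.IsHermitian then
    (hA.eigenvectorUnitary : Matrix n n ℂ) *
      Matrix.diagonal (fun i =>
        ((if hA.eigenvalues i = 0 then (0 : ℝ) else hA.eigenvalues i ^ t : ℝ) : ℂ)) *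
      (star (hA.eigenvectorUnitary : Matrix n n ℂ))
  else 0

/-- `dominates σ ρ` (written `σ ≫ ρ` in the paper): the kernel of `σ` is contained in
the kernel of `ρ`. -/
def dominates {n : Type*} [Fintype n] (σ ρ : Matrix n n ℂ) : Prop :=
  ∀ v : n → ℂ, σ.mulVec v = 0 → ρ.mulVec v = 0

/-- The sandwiched Rényi divergence of order `α`, with values in `ℝ ∪ {+∞}` (as a
subset of `EReal`), logarithms base 2. It is `+∞` unless `ρ` is not orthogonal to `σ`
(i.e. `Tr[ρσ] ≠ 0`) and (`σ ≫ ρ` or `α < 1`). -/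
noncomputable def Dtilde {n : Type*} [Fintype n] [DecidableEq n]
    (α : ℝ) (ρ σ : Matrix n n ℂ) : EReal :=
  if (ρ * σ).trace ≠ 0 ∧ (dominates σ ρ ∨ α < 1) then
    (((α - 1)⁻¹ * Real.logb 2
        ((matPow (matPow σ ((1 - α) / (2 * α)) * ρ * matPow σ ((1 - α) / (2 * α))) α).trace.re
          / ρ.trace.re) : ℝ) : EReal)
  else ⊤

/-- The auxiliary quantity
`D̃_α(ρ‖σ; τ) = (α/(α-1)) log₂ Tr[ρ^(1/2) σ^((1-α)/α) ρ^(1/2) τ^((α-1)/α)]`. -/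
noncomputable def Daux {n : Type*} [Fintype n] [DecidableEq n]
    (α : ℝ) (ρ σ τ : Matrix n n ℂ) : ℝ :=
  (α / (α - 1)) * Real.logb 2
    ((matPow ρ (1 / 2) * matPow σ ((1 - α) / α) * matPow ρ (1 / 2)
        * matPow τ ((α - 1) / α)).trace.re)

open Finset in
/-- The weighted power means `(∑ wᵢ xᵢ ^ s) ^ (1 / s)` are monotone in `s ≠ 0`, in logarithmic
form. -/
theorem inv_mul_log_sum_rpow_mono {ι : Type*} [Fintype ι] {w x : ι → ℝ} (hw : ∀ i, 0 ≤ w i)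
    (hw1 : ∑ i, w i = 1) (hx : ∀ i, 0 < x i) {s t : ℝ} (hs : s ≠ 0) (ht : t ≠ 0) (hst : s ≤ t) :
    s⁻¹ * Real.log (∑ i, w i * x i ^ s) ≤ t⁻¹ * Real.log (∑ i, w i * x i ^ t) := by
  have hpos : ∀ r : ℝ, 0 < ∑ i, w i * x i ^ r := fun r => by
    obtain ⟨i, -, hi⟩ : ∃ i ∈ univ, 0 < w i := by
      by_contra! hcon
      linarith [sum_nonpos hcon]
    exact sum_pos' (fun j _ => mul_nonneg (hw j) (Real.rpow_pos_of_pos (hx j) r).le)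
      ⟨i, mem_univ i, mul_pos hi (Real.rpow_pos_of_pos (hx i) r)⟩
  have hpow : ∀ {a b : ℝ}, a ≠ 0 → 1 ≤ b / a →
      b / a * Real.log (∑ i, w i * x i ^ a) ≤ Real.log (∑ i, w i * x i ^ b) := by
    intro a b ha hab
    rw [← Real.log_rpow (hpos a)]
    refine Real.log_le_log (Real.rpow_pos_of_pos (hpos a) _) ?_
    have := Real.rpow_arith_mean_le_arith_mean_rpow univ w (fun i => x i ^ a) (fun i _ => hw i)
      hw1 (fun i _ => (Real.rpow_pos_of_pos (hx i) a).le) hab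
    simpa only [← Real.rpow_mul (hx _).le, mul_div_cancel₀ b ha] using this
  have hjensen : ∀ r : ℝ, r * ∑ i, w i * Real.log (x i) ≤ Real.log (∑ i, w i * x i ^ r) := by
    intro r
    have := strictConcaveOn_log_Ioi.concaveOn.le_map_sum (t := univ) (w := w)
      (p := fun i => x i ^ r) (fun i _ => hw i) hw1 (fun i _ => Real.rpow_pos_of_pos (hx i) r)
    simp only [smul_eq_mul, Real.log_rpow (hx _)] at this
    refine le_of_eq_of_le ?_ this
    rw [mul_sum]
    exact sum_congr rfl fun i _ => by ring
  rcases lt_or_gt_of_ne hs with hs0 | hs0 <;> rcases lt_or_gt_of_ne ht with ht0 | ht0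
  · have h1 := mul_le_mul_of_nonpos_left
      (hpow ht ((one_le_div_of_neg ht0).2 hst)) (inv_nonpos.2 hs0.le)
    exact h1.trans_eq (by field_simp)
  · calc s⁻¹ * Real.log (∑ i, w i * x i ^ s)
        ≤ s⁻¹ * (s * ∑ i, w i * Real.log (x i)) :=
          mul_le_mul_of_nonpos_left (hjensen s) (inv_nonpos.2 hs0.le)
      _ = t⁻¹ * (t * ∑ i, w i * Real.log (x i)) := by
          rw [inv_mul_cancel_left₀ hs, inv_mul_cancel_left₀ ht]
      _ ≤ _ := mul_le_mul_of_nonneg_left (hjensen t) (inv_nonneg.2 ht0.le)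
  · linarith
  · have h1 := mul_le_mul_of_nonneg_left
      (hpow hs ((one_le_div hs0).2 hst)) (inv_nonneg.2 ht0.le)
    exact le_of_eq_of_le (by field_simp) h1

theorem matPow_isHermitian {n : Type*} [Fintype n] [DecidableEq n] (A : Matrix n n ℂ) (t : ℝ) :
    (matPow A t).IsHermitian := by
  unfold matPow
  split_ifs with hA
  · rw [star_eq_conjTranspose]
    refine isHermitian_mul_mul_conjTranspose _ ?_
    rw [isHermitian_diagonal_iff]
    intro i
    simp [isSelfAdjoint_iff]
  · exact isHermitian_zero

theorem matPow_half_mul_self {n : Type*} [Fintype n] [DecidableEq n] {A : Matrix n n ℂ}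
    (hA : A.PosSemidef) : matPow A (1 / 2) * matPow A (1 / 2) = A := by
  have hU : star (hA.1.eigenvectorUnitary : Matrix n n ℂ) * hA.1.eigenvectorUnitary = 1 :=
    Unitary.coe_star_mul_self _
  conv_rhs => rw [hA.1.spectral_theorem, Unitary.conjStarAlgAut_apply]
  rw [matPow, dif_pos hA.1]
  simp only [Matrix.mul_assoc]
  rw [← Matrix.mul_assoc (star _) (hA.1.eigenvectorUnitary : Matrix n n ℂ), hU, Matrix.one_mul,
    ← Matrix.mul_assoc (diagonal _) (diagonal _), diagonal_mul_diagonal]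
  congr 3
  ext i
  simp only [Function.comp_apply, ← Complex.ofReal_mul]
  congr 1
  split_ifs with h
  · simp [h]
  · rw [← Real.rpow_add_of_nonneg (hA.eigenvalues_nonneg i) (by norm_num) (by norm_num)]
    norm_num

theorem trace_mul_diagonal_mul_conjTranspose_mul_diagonal {m n : Type*} [Fintype m] [Fintype n]
    [DecidableEq m] [DecidableEq n] (M : Matrix m n ℂ) (d : n → ℝ) (e : m → ℝ) :
    (M * diagonal (fun k => (d k : ℂ)) * Mᴴ * diagonal (fun j => (e j : ℂ))).trace.re =
      ∑ p : m × n, Complex.normSq (M p.1 p.2) * (d p.2 * e p.1) := by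
  simp only [trace, diag_apply, Fintype.sum_prod_type, Complex.re_sum]
  refine Finset.sum_congr rfl fun j _ => ?_
  rw [mul_diagonal, mul_apply, Finset.sum_mul, Complex.re_sum]
  refine Finset.sum_congr rfl fun k _ => ?_
  rw [mul_diagonal, conjTranspose_apply]
  have : M j k * (d k : ℂ) * star (M j k) * (e j : ℂ) =
      ((Complex.normSq (M j k) * (d k * e j) : ℝ) : ℂ) := by
    push_cast
    rw [← Complex.mul_conj, starRingEnd_apply]
    ring
  rw [this, Complex.ofReal_re]

/-- The trace functional in `Daux` is a weighted power sum of ratios of eigenvalues, with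
probability weights independent of the exponent. -/
theorem exists_weights_trace_matPow {n : Type*} [Fintype n] [DecidableEq n]
    {ρ σ τ : Matrix n n ℂ} (hρ : ρ.PosSemidef) (hρtr : ρ.trace = 1) (hσ : σ.PosDef)
    (hτ : τ.PosDef) :
    ∃ w x : n × n → ℝ, (∀ p, 0 ≤ w p) ∧ ∑ p, w p = 1 ∧ (∀ p, 0 < x p) ∧
      ∀ s : ℝ, (matPow ρ (1 / 2) * matPow σ (-s) * matPow ρ (1 / 2) * matPow τ s).trace.re =
        ∑ p, w p * x p ^ s := by
  set U : Matrix n n ℂ := (hσ.1.eigenvectorUnitary : Matrix n n ℂ)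
  set V : Matrix n n ℂ := (hτ.1.eigenvectorUnitary : Matrix n n ℂ)
  have hUU : U * Uᴴ = 1 := Unitary.coe_mul_star_self hσ.1.eigenvectorUnitary
  have hVV : V * Vᴴ = 1 := Unitary.coe_mul_star_self hτ.1.eigenvectorUnitary
  set R := matPow ρ (1 / 2)
  have hRH : Rᴴ = R := matPow_isHermitian ρ _
  have hRR : R * R = ρ := matPow_half_mul_self hρ
  have htrace : ∀ d e : n → ℝ, (R * (U * diagonal (fun k => (d k : ℂ)) * Uᴴ) * R *
      (V * diagonal (fun j => (e j : ℂ)) * Vᴴ)).trace.re =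
      ∑ p : n × n, Complex.normSq ((Vᴴ * R * U) p.1 p.2) * (d p.2 * e p.1) := by
    intro d e
    rw [← trace_mul_diagonal_mul_conjTranspose_mul_diagonal, ← Matrix.mul_assoc, trace_mul_comm]
    simp only [conjTranspose_mul, conjTranspose_conjTranspose, hRH, Matrix.mul_assoc]
  refine ⟨fun p => Complex.normSq ((Vᴴ * R * U) p.1 p.2),
    fun p => hτ.1.eigenvalues p.1 / hσ.1.eigenvalues p.2, fun p => Complex.normSq_nonneg _, ?_,
    fun p => div_pos (hτ.eigenvalues_pos _) (hσ.eigenvalues_pos _), fun s => ?_⟩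
  · have := htrace (fun _ => 1) (fun _ => 1)
    simpa [hUU, hVV, hRR, hρtr] using this.symm
  · have hpow : ∀ {A : Matrix n n ℂ} (hA : A.PosDef) (t : ℝ), matPow A t =
        (hA.1.eigenvectorUnitary : Matrix n n ℂ) *
          diagonal (fun i => ((hA.1.eigenvalues i ^ t : ℝ) : ℂ)) *
          (hA.1.eigenvectorUnitary : Matrix n n ℂ)ᴴ := by
      intro A hA t
      simp only [matPow, dif_pos hA.1, (hA.eigenvalues_pos _).ne', if_false, star_eq_conjTranspose]
    rw [hpow hσ, hpow hτ, htrace]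
    refine Finset.sum_congr rfl fun p _ => ?_
    rw [Real.div_rpow (hτ.eigenvalues_pos _).le (hσ.eigenvalues_pos _).le,
      Real.rpow_neg (hσ.eigenvalues_pos _).le]
    ring


/-- the auxiliary quantity `D̃_α(ρ‖σ; τ)` is monotonically increasing
in `α` on `(0,1) ∪ (1,∞)`. -/
theorem stmt11 {n : ℕ} {ρ σ τ : Matrix (Fin n) (Fin n) ℂ}
    (hρ : ρ.PosSemidef) (hρtr : ρ.trace = 1) (hσ : σ.PosDef) (hτ : τ.PosDef)
    {α α' : ℝ} (hα : α ∈ Set.Ioo (0 : ℝ) 1 ∪ Set.Ioi 1)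
    (hα' : α' ∈ Set.Ioo (0 : ℝ) 1 ∪ Set.Ioi 1) (h : α ≤ α') :
    Daux α ρ σ τ ≤ Daux α' ρ σ τ := by
  obtain ⟨w, x, hw, hw1, hx, htr⟩ := exists_weights_trace_matPow hρ hρtr hσ hτ
  have hDaux : ∀ a ∈ Set.Ioo (0 : ℝ) 1 ∪ Set.Ioi 1, 0 < a ∧ (a - 1) / a ≠ 0 ∧
      Daux a ρ σ τ =
        ((a - 1) / a)⁻¹ * Real.log (∑ p, w p * x p ^ ((a - 1) / a)) / Real.log 2 := by
    intro a ha
    have ha0 : 0 < a := ha.elim (fun h => h.1) fun h => zero_lt_one.trans h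
    have ha1 : a ≠ 1 := ha.elim (fun h => h.2.ne) fun h => (Set.mem_Ioi.1 h).ne'
    refine ⟨ha0, div_ne_zero (sub_ne_zero.2 ha1) ha0.ne', ?_⟩
    have hneg : (1 - a) / a = -((a - 1) / a) := by ring
    rw [Daux, hneg, htr, inv_div, Real.logb, mul_div_assoc]
  obtain ⟨ha, hs, hD⟩ := hDaux α hα
  obtain ⟨ha', hs', hD'⟩ := hDaux α' hα'
  rw [hD, hD']
  refine div_le_div_of_nonneg_right (inv_mul_log_sum_rpow_mono hw hw1 hx hs hs' ?_)
    (Real.log_pos one_lt_two).le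
  rw [div_le_div_iff₀ ha ha']
  linarith
end

section
/- Let X, Y be positive definite complex n×n matrices and for α ∈ (0, ∞) set Z_α = Y^((1−α)/(2α)) · X · Y^((1−α)/(2α)). Then the function f : (0, ∞) → ℝ, f(α) = Tr[Z_α^α], is differentiable, with derivative f'(α) = Tr[Z_α^α · ln Z_α] − (1/α) · Tr[Z_α^α · ln Y] at every α ∈ (0, ∞); in particular, at α = 1 the derivative is f'(1) = Tr[X (ln X − ln Y)]. -/
open Matrix
open scoped Kronecker Classical ComplexOrder

/-- Natural matrix logarithm of a Hermitian matrix, by functional calculus, with the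
eigenvalue `0` mapped to `0`. -/
noncomputable def matLn {n : Type*} [Fintype n] [DecidableEq n]
    (A : Matrix n n ℂ) : Matrix n n ℂ :=
  if hA : A.IsHermitian then
    (hA.eigenvectorUnitary : Matrix n n ℂ) *
      Matrix.diagonal (fun i =>
        ((if hA.eigenvalues i = 0 then (0 : ℝ) else Real.log (hA.eigenvalues i) : ℝ) : ℂ)) *
      (star (hA.eigenvectorUnitary : Matrix n n ℂ))
  else 0

/-- `Z_α = Y^((1-α)/(2α)) X Y^((1-α)/(2α))`. -/
noncomputable def Zmat {n : Type*} [Fintype n] [DecidableEq n]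
    (X Y : Matrix n n ℂ) (a : ℝ) : Matrix n n ℂ :=
  matPow Y ((1 - a) / (2 * a)) * X * matPow Y ((1 - a) / (2 * a))


section
variable {n : Type*} [Fintype n] [DecidableEq n]

lemma matPow_eq_cfc {A : Matrix n n ℂ} (hA : A.IsHermitian) (t : ℝ) :
    matPow A t = cfc (fun x : ℝ => if x = 0 then 0 else x ^ t) A := by
  rw [hA.cfc_eq, matPow, dif_pos hA, IsHermitian.cfc, Unitary.conjStarAlgAut_apply]
  rfl

lemma matLn_eq_cfc {A : Matrix n n ℂ} (hA : A.IsHermitian) :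
    matLn A = cfc Real.log A := by
  have h : cfc Real.log A = cfc (fun x : ℝ => if x = 0 then 0 else Real.log x) A :=
    cfc_congr fun x _ => by split_ifs with h <;> simp [h]
  rw [h, hA.cfc_eq, matLn, dif_pos hA, IsHermitian.cfc, Unitary.conjStarAlgAut_apply]
  rfl

lemma spectrum_pos {A : Matrix n n ℂ} (hA : A.PosDef) {x : ℝ} (hx : x ∈ spectrum ℝ A) : 0 < x := by
  rw [hA.isHermitian.spectrum_real_eq_range_eigenvalues] at hx
  obtain ⟨i, rfl⟩ := hx
  exact hA.eigenvalues_pos i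

lemma matPow_eq_cfc_rpow {A : Matrix n n ℂ} (hA : A.PosDef) (t : ℝ) :
    matPow A t = cfc (fun x : ℝ => x ^ t) A := by
  rw [matPow_eq_cfc hA.isHermitian]
  exact cfc_congr fun x hx => if_neg (spectrum_pos hA hx).ne'

lemma matrix_cfc_mul {A : Matrix n n ℂ} (f g : ℝ → ℝ) :
    cfc f A * cfc g A = cfc (fun x => f x * g x) A := by
  refine (cfc_mul f g A ?_ ?_).symm <;>
  exact A.finite_real_spectrum.continuousOn _

lemma matrix_isHermitian_cfc (f : ℝ → ℝ) (A : Matrix n n ℂ) : (cfc f A).IsHermitian :=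
  cfc_predicate f A

lemma matPow_mul_matPow {A : Matrix n n ℂ} (hA : A.PosDef) (s t : ℝ) :
    matPow A s * matPow A t = matPow A (s + t) := by
  simp only [matPow_eq_cfc_rpow hA, matrix_cfc_mul]
  exact cfc_congr fun x hx => (Real.rpow_add (spectrum_pos hA hx) s t).symm

lemma matPow_one {A : Matrix n n ℂ} (hA : A.PosDef) : matPow A 1 = A := by
  simp only [matPow_eq_cfc_rpow hA, Real.rpow_one]
  exact cfc_id' ℝ A hA.isHermitian.isSelfAdjoint

lemma matPow_zero {A : Matrix n n ℂ} (hA : A.PosDef) : matPow A 0 = 1 := by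
  simp only [matPow_eq_cfc_rpow hA, Real.rpow_zero]
  exact cfc_const_one ℝ A hA.isHermitian.isSelfAdjoint

lemma posDef_Zmat {X Y : Matrix n n ℂ} (hX : X.PosDef) (hY : Y.PosDef) (a : ℝ) :
    (Zmat X Y a).PosDef := by
  set s := (1 - a) / (2 * a) with hs
  have hu : IsUnit (matPow Y s) := by
    refine IsUnit.of_mul_eq_one (matPow Y (-s)) ?_
    rw [matPow_mul_matPow hY, add_neg_cancel, matPow_zero hY]
  have hh : star (matPow Y s) = matPow Y s := by
    rw [matPow_eq_cfc_rpow hY]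
    exact matrix_isHermitian_cfc _ _
  have := (hu.posDef_star_left_conjugate_iff (x := X)).2 hX
  rwa [hh] at this

/-- The squared overlaps between the eigenvectors of two Hermitian matrices. -/
noncomputable def eigenOverlap {A B : Matrix n n ℂ} (hA : A.IsHermitian) (hB : B.IsHermitian)
    (i j : n) : ℝ :=
  ‖((star (hA.eigenvectorUnitary : Matrix n n ℂ)) * (hB.eigenvectorUnitary : Matrix n n ℂ)) i j‖ ^ 2

lemma trace_cfc_mul_cfc {A B : Matrix n n ℂ} (hA : A.IsHermitian) (hB : B.IsHermitian)
    (f g : ℝ → ℝ) :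
    (cfc f A * cfc g B).trace.re =
      ∑ i, ∑ j, eigenOverlap hA hB i j * (f (hA.eigenvalues i) * g (hB.eigenvalues j)) := by
  rw [hA.cfc_eq, hB.cfc_eq, IsHermitian.cfc, IsHermitian.cfc, Unitary.conjStarAlgAut_apply,
    Unitary.conjStarAlgAut_apply]
  set U := (hA.eigenvectorUnitary : Matrix n n ℂ)
  set V := (hB.eigenvectorUnitary : Matrix n n ℂ)
  set D := diagonal ((RCLike.ofReal : ℝ → ℂ) ∘ f ∘ hA.eigenvalues)
  set E := diagonal ((RCLike.ofReal : ℝ → ℂ) ∘ g ∘ hB.eigenvalues)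
  have h : (U * D * star U * (V * E * star V)).trace =
      (D * (star U * V) * (E * star (star U * V))).trace := by
    rw [star_mul, star_star]
    simp only [mul_assoc]
    rw [Matrix.trace_mul_comm U]
    simp only [mul_assoc]
  rw [h, Matrix.trace, Complex.re_sum]
  refine Finset.sum_congr rfl fun i _ => ?_
  rw [Matrix.diag_apply, Matrix.mul_apply, Complex.re_sum]
  refine Finset.sum_congr rfl fun j _ => ?_
  rw [Matrix.diagonal_mul, Matrix.diagonal_mul, Matrix.star_apply, eigenOverlap]
  have : (star U * V) i j * star ((star U * V) i j) = ((‖(star U * V) i j‖ ^ 2 : ℝ) : ℂ) := by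
    rw [RCLike.star_def, Complex.mul_conj']; norm_cast
  calc _ = ((((f (hA.eigenvalues i)) * (g (hB.eigenvalues j)) : ℝ) : ℂ) *
        ((star U * V) i j * star ((star U * V) i j))).re := by
        congr 1; simp; ring
    _ = _ := by rw [this, ← Complex.ofReal_mul, Complex.ofReal_re, mul_comm]

lemma eigenOverlap_nonneg {A B : Matrix n n ℂ} (hA : A.IsHermitian) (hB : B.IsHermitian)
    (i j : n) : 0 ≤ eigenOverlap hA hB i j := sq_nonneg _

lemma trace_cfc {A : Matrix n n ℂ} (hA : A.IsHermitian) (f : ℝ → ℝ) :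
    (cfc f A).trace.re = ∑ i, f (hA.eigenvalues i) := by
  rw [hA.cfc_eq, IsHermitian.cfc, Unitary.conjStarAlgAut_apply, Matrix.trace_mul_cycle]
  simp [Matrix.trace]

lemma eigenOverlap_le_one {A B : Matrix n n ℂ} (hA : A.IsHermitian) (hB : B.IsHermitian)
    (i j : n) : eigenOverlap hA hB i j ≤ 1 := by
  have h := entry_norm_bound_of_unitary
    (star hA.eigenvectorUnitary * hB.eigenvectorUnitary).2 i j
  exact pow_le_one₀ (norm_nonneg _) h

lemma trace_sub_mul_sub {A B : Matrix n n ℂ} (hA : A.IsHermitian) (hB : B.IsHermitian) :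
    ((A - B) * (A - B)).trace.re =
      ∑ i, ∑ j, eigenOverlap hA hB i j * (hA.eigenvalues i - hB.eigenvalues j) ^ 2 := by
  have e : ((A - B) * (A - B)).trace.re =
    (cfc (fun x : ℝ => x ^ 2) A * cfc (fun _ : ℝ => (1 : ℝ)) B).trace.re
      - 2 * (cfc (fun x : ℝ => x) A * cfc (fun x : ℝ => x) B).trace.re
      + (cfc (fun _ : ℝ => (1 : ℝ)) A * cfc (fun x : ℝ => x ^ 2) B).trace.re := by
    simp only [pow_two, ← matrix_cfc_mul, cfc_id' ℝ A hA.isSelfAdjoint, cfc_id' ℝ B hB.isSelfAdjoint, cfc_const_one ℝ A hA.isSelfAdjoint,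
      cfc_const_one ℝ B hB.isSelfAdjoint, mul_one, one_mul, sub_mul, mul_sub, Matrix.trace_sub, Complex.sub_re]
    rw [Matrix.trace_mul_comm B A]
    ring
  rw [e]
  simp only [trace_cfc_mul_cfc hA hB, Finset.mul_sum, ← Finset.sum_sub_distrib,
    ← Finset.sum_add_distrib]
  refine Finset.sum_congr rfl fun i _ => Finset.sum_congr rfl fun j _ => ?_
  ring

lemma trace_cfc_taylor {A B : Matrix n n ℂ} (hA : A.IsHermitian) (hB : B.IsHermitian)
    (f g h k : ℝ → ℝ) (c : ℝ) :
    (cfc f A).trace.re - (cfc g B).trace.re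
        - (c * (cfc h B).trace.re) - ((A - B) * cfc k B).trace.re =
      ∑ i, ∑ j, eigenOverlap hA hB i j * (f (hA.eigenvalues i) - g (hB.eigenvalues j)
        - c * h (hB.eigenvalues j)
        - (hA.eigenvalues i - hB.eigenvalues j) * k (hB.eigenvalues j)) := by
  have e : (cfc f A).trace.re - (cfc g B).trace.re
        - (c * (cfc h B).trace.re) - ((A - B) * cfc k B).trace.re =
    (cfc f A * cfc (fun _ : ℝ => (1 : ℝ)) B).trace.re
      - (cfc (fun _ : ℝ => (1 : ℝ)) A * cfc g B).trace.re
      - c * (cfc (fun _ : ℝ => (1 : ℝ)) A * cfc h B).trace.re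
      - ((cfc (fun x : ℝ => x) A * cfc k B).trace.re
        - (cfc (fun _ : ℝ => (1 : ℝ)) A * cfc (fun x : ℝ => x * k x) B).trace.re) := by
    simp only [← matrix_cfc_mul, cfc_id' ℝ A hA.isSelfAdjoint, cfc_id' ℝ B hB.isSelfAdjoint, cfc_const_one ℝ A hA.isSelfAdjoint,
      cfc_const_one ℝ B hB.isSelfAdjoint, mul_one, one_mul, sub_mul, Matrix.trace_sub, Complex.sub_re]
  rw [e]
  simp only [trace_cfc_mul_cfc hA hB, Finset.mul_sum, ← Finset.sum_sub_distrib]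
  refine Finset.sum_congr rfl fun i _ => Finset.sum_congr rfl fun j _ => ?_
  ring
open Filter Topology Asymptotics in
lemma isLittleO_mul_taylor_of_mul_sq_isBigO {F : ℝ → ℝ → ℝ} {φ w S : ℝ → ℝ} {α μ h k C : ℝ}
    (hF : HasFDerivAt (fun p : ℝ × ℝ => F p.1 p.2)
      (h • ContinuousLinearMap.fst ℝ ℝ ℝ + k • ContinuousLinearMap.snd ℝ ℝ ℝ) (α, μ))
    (hb : ∀ᶠ a in 𝓝 α, |F a (φ a)| ≤ C)
    (hw₀ : ∀ a, 0 ≤ w a) (hw₁ : ∀ a, w a ≤ 1) (hwS : ∀ a, w a * (φ a - μ) ^ 2 ≤ S a)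
    (hS : S =O[𝓝 α] fun a => (a - α) * (a - α)) :
    (fun a => w a * (F a (φ a) - F α μ - (a - α) * h - (φ a - μ) * k)) =o[𝓝 α]
      fun a => a - α := by
  obtain ⟨L, hL, hSL⟩ := hS.exists_pos
  rw [IsBigOWith_def] at hSL
  set M := √L
  have hM : M ^ 2 = L := Real.sq_sqrt hL.le
  have hM0 : 0 ≤ M := Real.sqrt_nonneg _
  rw [isLittleO_iff]
  intro c hc
  have hlo := (hasFDerivAt_iff_isLittleO.1 hF).def (c := c / (1 + M)) (by positivity)
  obtain ⟨δ, hδ, hball⟩ := Metric.eventually_nhds_iff.1 hlo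
  set T := (C + |F α μ| + |h|) / δ ^ 2 + |k| / δ with hT
  have hsmall : ∀ᶠ a in 𝓝 α, T * L * |a - α| < c := by
    have : Tendsto (fun a => T * L * |a - α|) (𝓝 α) (𝓝 (T * L * |α - α|)) :=
      (Continuous.tendsto (by fun_prop) α)
    rw [sub_self, abs_zero, mul_zero] at this
    exact this.eventually_lt_const hc
  filter_upwards [hb, hSL, hsmall, Metric.ball_mem_nhds α hδ, Metric.ball_mem_nhds α one_pos]
    with a ha hSa hsm had ha1
  rw [Metric.mem_ball, Real.dist_eq] at had ha1
  simp only [Real.norm_eq_abs, abs_mul, abs_mul_abs_self, abs_of_nonneg (hw₀ a)] at hSa ⊢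
  set x := φ a
  have hwx : w a * (x - μ) ^ 2 ≤ L * (a - α) ^ 2 :=
    (hwS a).trans ((le_abs_self _).trans (hSa.trans_eq (by ring)))
  rcases lt_or_ge |x - μ| δ with hx | hx
  · have h1 : |w a * (x - μ)| ≤ M * |a - α| := by
      refine abs_le_of_sq_le_sq ?_ (by positivity)
      rw [mul_pow, mul_pow, hM, sq_abs]
      refine le_trans ?_ hwx
      have := hw₀ a; have := hw₁ a
      exact mul_le_mul_of_nonneg_right (by nlinarith) (sq_nonneg _)
    rw [abs_mul, abs_of_nonneg (hw₀ a)] at h1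
    have h2 := hball (y := (a, x)) (by
      rw [Prod.dist_eq, Real.dist_eq, Real.dist_eq]; exact max_lt had hx)
    have h3 : ‖((a, x) : ℝ × ℝ) - (α, μ)‖ ≤ |a - α| + |x - μ| := by
      rw [Prod.mk_sub_mk, Prod.norm_mk, Real.norm_eq_abs, Real.norm_eq_abs]
      exact max_le_add_of_nonneg (abs_nonneg _) (abs_nonneg _)
    have h4 : |F a x - F α μ - (a - α) * h - (x - μ) * k| ≤
        c / (1 + M) * (|a - α| + |x - μ|) := by
      refine le_trans ?_ (h2.trans (mul_le_mul_of_nonneg_left h3 (by positivity)))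
      rw [Real.norm_eq_abs]
      apply le_of_eq
      congr 1
      simp
      ring
    calc _ ≤ w a * (c / (1 + M) * (|a - α| + |x - μ|)) :=
          mul_le_mul_of_nonneg_left h4 (hw₀ a)
      _ = c / (1 + M) * (w a * |a - α| + w a * |x - μ|) := by ring
      _ ≤ c / (1 + M) * (1 * |a - α| + M * |a - α|) := by
          have := hw₁ a
          gcongr
      _ = c * |a - α| := by field_simp
  · have h1 : 1 ≤ |x - μ| / δ := (one_le_div hδ).2 hx
    have h2 : 1 ≤ |x - μ| ^ 2 / δ ^ 2 := by rw [← div_pow]; exact one_le_pow₀ h1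
    have hC : 0 ≤ C := (abs_nonneg _).trans ha
    have h3 : |F a x - F α μ - (a - α) * h - (x - μ) * k| ≤ T * (x - μ) ^ 2 := by
      calc _ ≤ |F a x| + |F α μ| + |a - α| * |h| + |x - μ| * |k| := by
            rw [← abs_mul, ← abs_mul]
            refine (abs_sub _ _).trans (add_le_add_left ((abs_sub _ _).trans
              (add_le_add_left (abs_sub _ _) _)) _)
        _ ≤ (C + |F α μ| + |h|) * 1 + |x - μ| * |k| * 1 := by
            have : |a - α| * |h| ≤ 1 * |h| := by gcongr
            linarith
        _ ≤ (C + |F α μ| + |h|) * (|x - μ| ^ 2 / δ ^ 2) + |x - μ| * |k| * (|x - μ| / δ) := by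
            gcongr
        _ = T * |x - μ| ^ 2 := by rw [hT]; ring
        _ = T * (x - μ) ^ 2 := by rw [sq_abs]
    have hT0 : 0 ≤ T := by positivity
    calc _ ≤ w a * (T * (x - μ) ^ 2) := mul_le_mul_of_nonneg_left h3 (hw₀ a)
      _ = T * (w a * (x - μ) ^ 2) := by ring
      _ ≤ T * (L * (a - α) ^ 2) := mul_le_mul_of_nonneg_left hwx hT0
      _ = T * L * |a - α| * |a - α| := by rw [mul_assoc (T * L), abs_mul_abs_self]; ring
      _ ≤ c * |a - α| := mul_le_mul_of_nonneg_right hsm.le (abs_nonneg _)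

open scoped Matrix.Norms.Frobenius

lemma hasDerivAt_cfc_param {A : Matrix n n ℂ} (hA : A.IsHermitian) {f : ℝ → ℝ → ℝ} {f' : ℝ → ℝ}
    {α : ℝ} (hf : ∀ i, HasDerivAt (fun a => f a (hA.eigenvalues i)) (f' (hA.eigenvalues i)) α) :
    HasDerivAt (fun a => cfc (f a) A) (cfc f' A) α := by
  have h (g : ℝ → ℝ) : cfc g A = ∑ i, g (hA.eigenvalues i) •
      ((hA.eigenvectorUnitary : Matrix n n ℂ) * Matrix.single i i 1 *
        star (hA.eigenvectorUnitary : Matrix n n ℂ)) := by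
    rw [hA.cfc_eq, IsHermitian.cfc, Unitary.conjStarAlgAut_apply, ← Matrix.sum_single_eq_diagonal,
      Finset.mul_sum, Finset.sum_mul]
    refine Finset.sum_congr rfl fun i _ => ?_
    rw [← smul_mul_assoc, ← mul_smul_comm, Matrix.smul_single]
    simp
  simp only [h]
  exact HasDerivAt.fun_sum fun i _ => (hf i).smul_const _

/-- The real part of the trace, as a continuous real-linear functional. -/
noncomputable def reTraceCLM : Matrix n n ℂ →L[ℝ] ℝ :=
  LinearMap.toContinuousLinearMap (Complex.reLm ∘ₗ Matrix.traceLinearMap n ℝ ℂ)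

open Filter Topology Asymptotics in
lemma hasDerivAt_trace_cfc {Z : ℝ → Matrix n n ℂ} {Z' : Matrix n n ℂ} {F : ℝ → ℝ → ℝ}
    {Fa Fx : ℝ → ℝ} {α C : ℝ} (hZ : ∀ a, (Z a).IsHermitian) (hd : HasDerivAt Z Z' α)
    (hF : ∀ j, HasFDerivAt (fun p : ℝ × ℝ => F p.1 p.2)
      (Fa ((hZ α).eigenvalues j) • ContinuousLinearMap.fst ℝ ℝ ℝ
        + Fx ((hZ α).eigenvalues j) • ContinuousLinearMap.snd ℝ ℝ ℝ) (α, (hZ α).eigenvalues j))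
    (hb : ∀ᶠ a in 𝓝 α, ∀ i, |F a ((hZ a).eigenvalues i)| ≤ C) :
    HasDerivAt (fun a => (cfc (F a) (Z a)).trace.re)
      ((cfc Fa (Z α)).trace.re + (Z' * cfc Fx (Z α)).trace.re) α := by
  have hS : (fun a => ((Z a - Z α) * (Z a - Z α)).trace.re) =O[𝓝 α]
      fun a => (a - α) * (a - α) :=
    (reTraceCLM.isBigO_comp _ _).trans (hd.isBigO_sub.mul hd.isBigO_sub)
  have hrem : (fun a => (cfc (F a) (Z a)).trace.re - (cfc (F α) (Z α)).trace.re
      - (a - α) * (cfc Fa (Z α)).trace.re - ((Z a - Z α) * cfc Fx (Z α)).trace.re) =o[𝓝 α]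
      fun a => a - α := by
    simp only [trace_cfc_taylor (hZ _) (hZ α)]
    refine IsLittleO.fun_sum fun i _ => IsLittleO.fun_sum fun j _ => ?_
    refine isLittleO_mul_taylor_of_mul_sq_isBigO (hF j) (hb.mono fun a h => h i)
      (fun a => eigenOverlap_nonneg _ _ i j) (fun a => eigenOverlap_le_one _ _ i j)
      (fun a => ?_) hS
    rw [trace_sub_mul_sub (hZ a) (hZ α)]
    have hnn (i j : n) : 0 ≤ eigenOverlap (hZ a) (hZ α) i j *
        ((hZ a).eigenvalues i - (hZ α).eigenvalues j) ^ 2 :=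
      mul_nonneg (eigenOverlap_nonneg _ _ i j) (sq_nonneg _)
    refine le_trans ?_ (Finset.single_le_sum
      (fun i _ => Finset.sum_nonneg fun j _ => hnn i j) (Finset.mem_univ i))
    exact Finset.single_le_sum (fun j _ => hnn i j) (Finset.mem_univ j)
  have hlin : HasDerivAt (fun a => ((Z a - Z α) * cfc Fx (Z α)).trace.re)
      ((Z' * cfc Fx (Z α)).trace.re) α :=
    (reTraceCLM (n := n)).hasFDerivAt.comp_hasDerivAt α
      ((hd.sub_const (Z α)).mul_const (cfc Fx (Z α)))
  rw [hasDerivAt_iff_isLittleO] at hlin ⊢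
  refine (hrem.add hlin).congr_left fun a => ?_
  simp
  ring

open Filter Topology in
lemma eventually_eigenvalues_le {Z : ℝ → Matrix n n ℂ} {α : ℝ} (hZ : ∀ a, (Z a).IsHermitian)
    (hc : ContinuousAt Z α) : ∃ K, 1 ≤ K ∧ ∀ᶠ a in 𝓝 α, ∀ i, (hZ a).eigenvalues i ≤ K := by
  have ht : ContinuousAt (fun a => (Z a * Z a).trace.re) α :=
    (reTraceCLM (n := n)).continuous.continuousAt.comp (hc.mul hc)
  refine ⟨|(Z α * Z α).trace.re| + 2, by linarith [abs_nonneg (Z α * Z α).trace.re], ?_⟩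
  filter_upwards [ht.eventually_lt_const (lt_add_one _)] with a ha i
  have h : (Z a * Z a).trace.re = ∑ i, (hZ a).eigenvalues i ^ 2 := by
    rw [← trace_cfc (hZ a) (fun x => x ^ 2)]
    simp only [pow_two, ← matrix_cfc_mul, cfc_id' ℝ (Z a) (hZ a).isSelfAdjoint]
  have h1 : (hZ a).eigenvalues i ^ 2 ≤ (Z a * Z a).trace.re := by
    rw [h]
    exact Finset.single_le_sum (f := fun i => (hZ a).eigenvalues i ^ 2)
      (fun i _ => sq_nonneg _) (Finset.mem_univ i)
  nlinarith [le_abs_self (Z α * Z α).trace.re, abs_nonneg (Z α * Z α).trace.re]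

lemma hasDerivAt_Zmat {X Y : Matrix n n ℂ} (hY : Y.PosDef) {α : ℝ} (hα : 0 < α) :
    HasDerivAt (Zmat X Y)
      (-(1 / (2 * α ^ 2)) • (matLn Y * Zmat X Y α + Zmat X Y α * matLn Y)) α := by
  have hs : HasDerivAt (fun a : ℝ => (1 - a) / (2 * a)) (-(1 / (2 * α ^ 2))) α := by
    have := ((hasDerivAt_id α).const_sub 1).div ((hasDerivAt_id α).const_mul 2)
      (by simpa using hα.ne')
    refine this.congr_deriv ?_
    simp only [id]
    field_simp
    ring
  set s := (1 - α) / (2 * α) with hsdef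
  have hW : HasDerivAt (fun a : ℝ => matPow Y ((1 - a) / (2 * a)))
      (-(1 / (2 * α ^ 2)) • (matLn Y * matPow Y s)) α := by
    have h := hasDerivAt_cfc_param hY.isHermitian
      (f := fun a x => x ^ ((1 - a) / (2 * a)))
      (f' := fun x => -(1 / (2 * α ^ 2)) * (Real.log x * x ^ s)) (α := α) (fun i => by
        convert hs.const_rpow (hY.eigenvalues_pos i) using 1
        ring)
    simp only [matPow_eq_cfc_rpow hY, matLn_eq_cfc hY.isHermitian, matrix_cfc_mul]
    rwa [cfc_const_mul _ _ _ (Y.finite_real_spectrum.continuousOn _)] at h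
  have hcomm : matLn Y * matPow Y s = matPow Y s * matLn Y := by
    simp only [matPow_eq_cfc_rpow hY, matLn_eq_cfc hY.isHermitian, matrix_cfc_mul, mul_comm]
  have h := (hW.mul_const X).mul hW
  refine HasDerivAt.congr_deriv (f := Zmat X Y) h ?_
  simp only [Zmat, ← hsdef, smul_mul_assoc, mul_smul_comm, ← smul_add]
  rw [hcomm]
  simp only [← mul_assoc]
  rw [hcomm]

open Filter Topology in
lemma hasDerivAt_trace_matPow_Zmat {X Y : Matrix n n ℂ} (hX : X.PosDef) (hY : Y.PosDef)
    {α : ℝ} (hα : 0 < α) :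
    HasDerivAt (fun a : ℝ => (matPow (Zmat X Y a) a).trace.re)
      ((matPow (Zmat X Y α) α * matLn (Zmat X Y α)).trace.re
        - α⁻¹ * (matPow (Zmat X Y α) α * matLn Y).trace.re) α := by
  have hZ (a : ℝ) := posDef_Zmat hX hY a
  have hZH (a : ℝ) := (hZ a).isHermitian
  have hd := hasDerivAt_Zmat (X := X) hY hα
  obtain ⟨K, hK1, hK⟩ := eventually_eigenvalues_le hZH hd.continuousAt
  have hmain := hasDerivAt_trace_cfc (F := fun a x => x ^ a) (Fa := fun x => x ^ α * Real.log x)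
    (Fx := fun x => α * x ^ (α - 1)) (C := K ^ (2 * α)) hZH hd (fun j => by
      have h := (Real.hasStrictFDerivAt_rpow_of_pos ((hZH α).eigenvalues j, α)
        ((hZ α).eigenvalues_pos j)).hasFDerivAt
      have hsw : HasFDerivAt (fun p : ℝ × ℝ => (p.2, p.1))
          ((ContinuousLinearMap.snd ℝ ℝ ℝ).prod (ContinuousLinearMap.fst ℝ ℝ ℝ))
          (α, (hZH α).eigenvalues j) := hasFDerivAt_snd.prodMk hasFDerivAt_fst
      refine (h.comp (α, (hZH α).eigenvalues j) hsw).congr_fderiv ?_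
      ext <;> simp) (by
      filter_upwards [hK, eventually_gt_nhds hα, eventually_lt_nhds (show α < 2 * α by linarith)]
        with a ha ha0 ha2 i
      have hpos := (hZ a).eigenvalues_pos i
      rw [abs_of_nonneg (Real.rpow_nonneg hpos.le _)]
      exact (Real.rpow_le_rpow hpos.le (ha i) ha0.le).trans
        (Real.rpow_le_rpow_of_exponent_le hK1 ha2.le))
  rw [cfc_const_mul _ _ _ ((Zmat X Y α).finite_real_spectrum.continuousOn _),
    ← matrix_cfc_mul] at hmain
  simp only [← matPow_eq_cfc_rpow (hZ _), ← matLn_eq_cfc (hZH _)] at hmain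
  refine hmain.congr_deriv ?_
  rw [sub_eq_add_neg _ (α⁻¹ * _)]
  congr 1
  set P := matPow (Zmat X Y α) α with hP
  set Q := matPow (Zmat X Y α) (α - 1) with hQ
  have hZQ : Zmat X Y α * Q = P := by
    rw [hQ, hP]
    nth_rewrite 1 [← matPow_one (hZ α)]
    rw [matPow_mul_matPow (hZ α), add_sub_cancel]
  have hQZ : Q * Zmat X Y α = P := by
    rw [hQ, hP]
    nth_rewrite 2 [← matPow_one (hZ α)]
    rw [matPow_mul_matPow (hZ α), sub_add_cancel]
  have h1 : (matLn Y * Zmat X Y α * Q).trace = (P * matLn Y).trace := by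
    rw [mul_assoc, hZQ, Matrix.trace_mul_comm]
  have h2 : (Zmat X Y α * matLn Y * Q).trace = (P * matLn Y).trace := by
    rw [Matrix.trace_mul_comm, ← mul_assoc, hQZ]
  rw [smul_mul_assoc, mul_smul_comm, add_mul, Matrix.trace_smul, Matrix.trace_smul,
    Matrix.trace_add, h1, h2, Complex.smul_re, Complex.smul_re, Complex.add_re, smul_eq_mul,
    smul_eq_mul]
  field_simp
  ring

lemma Zmat_one {X Y : Matrix n n ℂ} (hY : Y.PosDef) : Zmat X Y 1 = X := by
  simp [Zmat, matPow_zero hY]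

end

/-- differentiability of `α ↦ Tr[Z_α^α]` on `(0, ∞)` with derivative
`Tr[Z_α^α ln Z_α] - (1/α) Tr[Z_α^α ln Y]`; in particular, at `α = 1` the derivative
equals `Tr[X (ln X - ln Y)]`. -/
theorem stmt13 {n : ℕ} {X Y : Matrix (Fin n) (Fin n) ℂ}
    (hX : X.PosDef) (hY : Y.PosDef) :
    (∀ α ∈ Set.Ioi (0 : ℝ),
      HasDerivAt (fun a : ℝ => (matPow (Zmat X Y a) a).trace.re)
        ((matPow (Zmat X Y α) α * matLn (Zmat X Y α)).trace.re
          - α⁻¹ * (matPow (Zmat X Y α) α * matLn Y).trace.re) α) ∧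
    (matPow (Zmat X Y 1) 1 * matLn (Zmat X Y 1)).trace.re
        - (1 : ℝ)⁻¹ * (matPow (Zmat X Y 1) 1 * matLn Y).trace.re
      = (X * (matLn X - matLn Y)).trace.re := by
  refine ⟨fun α hα => hasDerivAt_trace_matPow_Zmat hX hY hα, ?_⟩
  rw [Zmat_one hY, matPow_one hX, inv_one, one_mul, mul_sub, Matrix.trace_sub, Complex.sub_re]
end
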